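/- Let n ≥ 1 and let X, Y be consistent subsets of binom([n], 3) with X ⊊ Y. Then there exists a triple I ∈ Y ∖ X such that X ∪ {I} is consistent; that is, the ascent set Asc(X, Y) is nonempty. -/

import Mathlib

open Finset

/-- `[n] = {1, …, n}`. -/
def box (n : ℕ) : Finset ℕ := Finset.Icc 1 n

/-- `binom([n], k)`, the set of `k`-element subsets of `[n]`. -/
def binom (n k : ℕ) : Finset (Finset ℕ) := Finset.powersetCard k (box n)

/-- `X ⊆ binom([n], d+1)` is closed if for every `(d-1)`-subset `I` of `[n]` and all
`i < j < k` in `[n] ∖ I`, membership of `I∪{i,j}` and `I∪{j,k}` in `X` forces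
`I∪{i,k} ∈ X`. -/
def IsClosedSet (n d : ℕ) (X : Finset (Finset ℕ)) : Prop :=
  ∀ I ∈ binom n (d - 1), ∀ i ∈ box n, ∀ j ∈ box n, ∀ k ∈ box n,
    i ∉ I → j ∉ I → k ∉ I → i < j → j < k →
      I ∪ {i, j} ∈ X → I ∪ {j, k} ∈ X → I ∪ {i, k} ∈ X

/-- `X` is a consistent subset of `binom([n], d+1)`:
both `X` and its complement in `binom([n], d+1)` are closed. -/
def Consistent (n d : ℕ) (X : Finset (Finset ℕ)) : Prop :=
  X ⊆ binom n (d + 1) ∧ IsClosedSet n d X ∧ IsClosedSet n d (binom n (d + 1) \ X)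

open Classical in
/-- The smallest closed subset of `binom([n], d+1)` containing `S`. -/
noncomputable def closureHB (n d : ℕ) (S : Finset (Finset ℕ)) : Finset (Finset ℕ) :=
  (binom n (d + 1)).filter fun I =>
    ∀ T ⊆ binom n (d + 1), S ⊆ T → IsClosedSet n d T → I ∈ T

open Classical in
/-- The ascent set `Asc(X, Y) = {I ∈ Y ∖ X : X ∪ {I} is consistent}`. -/
noncomputable def ascSet (n d : ℕ) (X Y : Finset (Finset ℕ)) : Finset (Finset ℕ) :=
  (Y \ X).filter fun I => Consistent n d (X ∪ {I})

/-- The pattern of an initial or final segment of a packet of four triples. -/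
def IsSegment (A B C D : Prop) : Prop :=
  (A → C → B) ∧ (A → D → B) ∧ (A → D → C) ∧ (B → D → C) ∧
    (¬A → ¬C → ¬B) ∧ (¬A → ¬D → ¬B) ∧ (¬A → ¬D → ¬C) ∧ (¬B → ¬D → ¬C)

/-- A symmetric ternary relation meeting every packet of `[n]` in an initial or final segment. -/
structure IsArrangement (n : ℕ) (x : ℕ → ℕ → ℕ → Prop) : Prop where
  swap_left : ∀ a b c, x a b c ↔ x b a c
  swap_right : ∀ a b c, x a b c ↔ x a c b
  segment : ∀ a ∈ box n, ∀ b ∈ box n, ∀ c ∈ box n, ∀ d ∈ box n, a < b → b < c → c < d →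
    IsSegment (x a b c) (x a b d) (x a c d) (x b c d)

/-- On line `i` of the pseudoline arrangement with inverted triples `x`, the crossing with `j`
precedes the crossing with `k`. -/
def Before (x : ℕ → ℕ → ℕ → Prop) (i j k : ℕ) : Prop :=
  (j < k ∧ ¬x i j k) ∨ (k < j ∧ x i j k)

/-- The triple is inverted in `y` but not in `x`. -/
def Red (x y : ℕ → ℕ → ℕ → Prop) (i j k : ℕ) : Prop :=
  y i j k ∧ ¬x i j k

variable {n : ℕ} {x y : ℕ → ℕ → ℕ → Prop} {a b c d i j k m p q : ℕ}

theorem Before.ne (h : Before x i j k) : j ≠ k := by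
  unfold Before at h; omega

theorem IsArrangement.before_total (hx : IsArrangement n x) (i : ℕ) (h : j ≠ k) :
    Before x i j k ∨ Before x i k j := by
  have := hx.swap_right i j k
  unfold Before; grind

theorem IsArrangement.not_before (hx : IsArrangement n x) (h : Before x i j k) :
    ¬Before x i k j := by
  have := hx.swap_right i j k
  unfold Before at *; grind

theorem IsArrangement.perm (hx : IsArrangement n x) (a b c : ℕ) :
    (x a c b ↔ x a b c) ∧ (x b a c ↔ x a b c) ∧ (x b c a ↔ x a b c) ∧
      (x c a b ↔ x a b c) ∧ (x c b a ↔ x a b c) := by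
  have e₁ := hx.swap_left
  have e₂ := hx.swap_right
  refine ⟨?_, ?_, ?_, ?_, ?_⟩
  · rw [e₂]
  · rw [e₁]
  · rw [e₂, e₁]
  · rw [e₁, e₂]
  · rw [e₂, e₁, e₂]

theorem IsArrangement.line_trans (hx : IsArrangement n x) (hi : i ∈ box n) (ha : a ∈ box n)
    (hb : b ∈ box n) (hc : c ∈ box n) (hia : i ≠ a) (hib : i ≠ b) (hic : i ≠ c) (hab : a < b)
    (hbc : b < c) : (x i a b → x i b c → x i a c) ∧ (¬x i a b → ¬x i b c → ¬x i a c) := by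
  have := hx.perm i a b
  have := hx.perm i a c
  have := hx.perm i b c
  have s := hx.segment
  rcases lt_or_gt_of_ne hia with h | h
  · have := s i hi a ha b hb c hc h hab hbc
    unfold IsSegment at this; grind
  rcases lt_or_gt_of_ne hib with h' | h'
  · have := s a ha i hi b hb c hc h h' hbc
    unfold IsSegment at this; grind
  rcases lt_or_gt_of_ne hic with h'' | h''
  · have := s a ha b hb i hi c hc hab h' h''
    unfold IsSegment at this; grind
  · have := s a ha b hb c hc i hi hab hbc h''
    unfold IsSegment at this; grind

theorem IsArrangement.before_trans (hx : IsArrangement n x) (hi : i ∈ box n) (hj : j ∈ box n)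
    (hk : k ∈ box n) (hm : m ∈ box n) (hij : i ≠ j) (hik : i ≠ k) (him : i ≠ m)
    (h₁ : Before x i j k) (h₂ : Before x i k m) : Before x i j m := by
  have hjm : j ≠ m := by
    rintro rfl
    exact hx.not_before h₁ h₂
  have e₂ := hx.swap_right
  have r₁ := e₂ i j k
  have r₂ := e₂ i k m
  have r₃ := e₂ i j m
  have t₁ := hx.line_trans hi hj hk hm hij hik him
  have t₂ := hx.line_trans hi hj hm hk hij him hik
  have t₃ := hx.line_trans hi hk hj hm hik hij him
  have t₄ := hx.line_trans hi hk hm hj hik him hij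
  have t₅ := hx.line_trans hi hm hj hk him hij hik
  have t₆ := hx.line_trans hi hm hk hj him hik hij
  have hjk := h₁.ne
  have hkm := h₂.ne
  unfold Before at *
  clear e₂
  rcases lt_or_gt_of_ne hjk with h | h <;> rcases lt_or_gt_of_ne hkm with h' | h' <;>
    rcases lt_or_gt_of_ne hjm with h'' | h'' <;> grind

/-- The number of crossings on line `i` preceding the one with `j`. -/
noncomputable def position (n : ℕ) (x : ℕ → ℕ → ℕ → Prop) (i j : ℕ) : ℕ :=
  open Classical in ((box n).filter fun m => m ≠ i ∧ Before x i m j).card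

theorem IsArrangement.position_lt (hx : IsArrangement n x) (hi : i ∈ box n) (hj : j ∈ box n)
    (hk : k ∈ box n) (hij : i ≠ j) (hik : i ≠ k) (h : Before x i j k) :
    position n x i j < position n x i k := by
  classical
  apply Finset.card_lt_card
  rw [Finset.ssubset_iff_of_subset]
  · exact ⟨j, by simp [hj, hij.symm, h], fun h' => (Finset.mem_filter.1 h').2.2.ne rfl⟩
  · intro m hm
    simp only [Finset.mem_filter] at hm ⊢
    exact ⟨hm.1, hm.2.1, hx.before_trans hi hm.1 hj hk hm.2.1.symm hij hik hm.2.2 h⟩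

theorem Red.before_iff (h : Red x y i j k) : Before x i j k ↔ j < k := by
  unfold Red at h; unfold Before; tauto

theorem Red.rotate (hx : IsArrangement n x) (hy : IsArrangement n y) (h : Red x y i j k) :
    Red x y j i k := by
  rwa [Red, ← hx.swap_left, ← hy.swap_left]

theorem Red.swap (hx : IsArrangement n x) (hy : IsArrangement n y) (h : Red x y i j k) :
    Red x y i k j := by
  rwa [Red, ← hx.swap_right, ← hy.swap_right]

theorem Red.split (hy : IsArrangement n y) (hxy : ∀ a b c, x a b c → y a b c)
    (hi : i ∈ box n) (hj : j ∈ box n) (hk : k ∈ box n) (hm : m ∈ box n)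
    (hij : i ≠ j) (hik : i ≠ k) (him : i ≠ m) (h : Red x y i j k) (hjk : j < k)
    (h₁ : Before x i j m) (h₂ : Before x i m k) : Red x y i j m ∨ Red x y i m k := by
  by_contra hc
  have mono : ∀ j k, ¬Red x y i j k → Before x i j k → Before y i j k := by
    intro j k h h'
    rcases h' with ⟨h₁, h₂⟩ | ⟨h₁, h₂⟩
    · exact Or.inl ⟨h₁, fun h₃ => h ⟨h₃, h₂⟩⟩
    · exact Or.inr ⟨h₁, hxy _ _ _ h₂⟩
  push Not at hc
  rcases hy.before_trans hi hj hm hk hij him hik (mono _ _ hc.1 h₁) (mono _ _ hc.2 h₂) with h' | h'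
  · exact h'.2 h.1
  · omega

/-- `p < c < q` is a red triple whose middle line has consecutive crossings with `p` and `q`. -/
structure MidAdjacent (n : ℕ) (x y : ℕ → ℕ → ℕ → Prop) (p c q : ℕ) : Prop where
  mem_left : p ∈ box n
  mem_mid : c ∈ box n
  mem_right : q ∈ box n
  left_lt : p < c
  lt_right : c < q
  red : Red x y c p q
  adjacent : ∀ m ∈ box n, m ≠ c → Before x c p m → ¬Before x c m q

theorem exists_midAdjacent (hx : IsArrangement n x) (hy : IsArrangement n y)
    (hxy : ∀ a b c, x a b c → y a b c)
    (h : ∃ a ∈ box n, ∃ b ∈ box n, ∃ c ∈ box n, a < b ∧ b < c ∧ Red x y b a c) :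
    ∃ p c q, MidAdjacent n x y p c q := by
  classical
  let S := (box n).filter fun N => ∃ a ∈ box n, ∃ b ∈ box n, a < b ∧ b < N ∧ Red x y b a N
  have hS : S.Nonempty := by
    obtain ⟨a, ha, b, hb, c, hc, h₁, h₂, h₃⟩ := h
    exact ⟨c, Finset.mem_filter.2 ⟨hc, a, ha, b, hb, h₁, h₂, h₃⟩⟩
  obtain ⟨N, hNS, hNmin⟩ := Finset.exists_min_image S id hS
  obtain ⟨hN, a₀, ha₀, b₀, hb₀, hab₀, hbN₀, hred₀⟩ := Finset.mem_filter.1 hNS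
  let B := (box n).filter fun b => b < N ∧ ∃ a ∈ box n, a < b ∧ Red x y b a N
  obtain ⟨b, hbB, hbmax⟩ := Finset.exists_max_image B id
    ⟨b₀, Finset.mem_filter.2 ⟨hb₀, hbN₀, a₀, ha₀, hab₀, hred₀⟩⟩
  obtain ⟨hb, hbN, a, ha, hab, hred⟩ := Finset.mem_filter.1 hbB
  have haN : Before x b a N := hred.before_iff.2 (by omega)
  let P := (box n).filter fun m => m < N ∧ m ≠ b ∧ (m = a ∨ Before x b a m) ∧ Before x b m N
  obtain ⟨p, hpP, hpmax⟩ := Finset.exists_max_image P (position n x b)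
    ⟨a, Finset.mem_filter.2 ⟨ha, by omega, by omega, Or.inl rfl, haN⟩⟩
  obtain ⟨hp, hpN, hpb, hap, hpN'⟩ := Finset.mem_filter.1 hpP
  have hpred : Red x y b p N := by
    rcases hap with rfl | hap
    · exact hred
    · rcases hred.split hy hxy hb ha hN hp (by omega) (by omega) (by omega) (by omega) hap hpN'
        with h | h
      · exfalso
        have hlt : a < p := h.before_iff.1 hap
        rcases lt_or_gt_of_ne hpb with hpb' | hpb'
        · have := hNmin b (Finset.mem_filter.2 ⟨hb, a, ha, p, hp, hlt, hpb',
            ((h.swap hx hy).rotate hx hy).swap hx hy⟩)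
          simp at this; omega
        · have := hNmin p (Finset.mem_filter.2 ⟨hp, a, ha, b, hb, hab, hpb', h⟩)
          simp at this; omega
      · exact h
  have hpb' : p < b := by
    by_contra hc
    have := hbmax p (Finset.mem_filter.2 ⟨hp, hpN, b, hb, by omega, hpred.rotate hx hy⟩)
    simp at this; omega
  let Q := (box n).filter fun m => m ≠ b ∧ Before x b p m ∧ (m = N ∨ Before x b m N)
  obtain ⟨l, hlQ, hlmin⟩ := Finset.exists_min_image Q (position n x b)
    ⟨N, Finset.mem_filter.2 ⟨hN, by omega, hpN', Or.inl rfl⟩⟩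
  obtain ⟨hl, hlb, hpl, hlN⟩ := Finset.mem_filter.1 hlQ
  have hadj : ∀ m ∈ box n, m ≠ b → Before x b p m → ¬Before x b m l := by
    intro m hm hmb h₁ h₂
    have h₃ : Before x b m N := by
      rcases hlN with rfl | h
      · exact h₂
      · exact hx.before_trans hb hm hl hN hmb.symm hlb.symm (by omega) h₂ h
    have h₄ := hlmin m (Finset.mem_filter.2 ⟨hm, hmb, h₁, Or.inr h₃⟩)
    have h₅ := hx.position_lt hb hm hl hmb.symm hlb.symm h₂
    omega
  rcases hlN with rfl | hlN
  · exact ⟨p, b, l, hp, hb, hl, hpb', hbN, hpred, hadj⟩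
  have hNl : N < l := by
    by_contra hc
    have := hlN.ne
    have hal : Before x b a l := by
      rcases hap with rfl | hap
      · exact hpl
      · exact hx.before_trans hb ha hp hl (by omega) hpb.symm hlb.symm hap hpl
    have h₄ := hpmax l (Finset.mem_filter.2 ⟨hl, by omega, hlb, Or.inr hal, hlN⟩)
    have h₅ := hx.position_lt hb hp hl hpb.symm hlb.symm hpl
    omega
  rcases hpred.split hy hxy hb hp hN hl hpb.symm (by omega) hlb.symm hpN hpl hlN with h | h
  · exact ⟨p, b, l, hp, hb, hl, hpb', by omega, h, hadj⟩
  · have := h.before_iff.1 hlN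
    omega

theorem MidAdjacent.crossing (hx : IsArrangement n x) (hy : IsArrangement n y)
    (hxy : ∀ a b c, x a b c → y a b c) (h : MidAdjacent n x y p c q) (hm : m ∈ box n)
    (hmp : m ≠ p) (hmc : m ≠ c) (hmq : m ≠ q) :
    (Before x p c m ∧ Before x p m q ↔ Before x q p m ∧ Before x q m c) ∧
    (Before x p c m → Before x p m q → p < m ∧ m < q ∧ Red x y m p q) := by
  obtain ⟨hp, hc, hq, hpc, hcq, hred, hadj⟩ := h
  have hadj := hadj m hm hmc
  have := hx.perm m p c
  have := hx.perm m p q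
  have := hx.perm m c q
  have := hx.perm p c q
  have := hy.perm m p c
  have := hy.perm m p q
  have := hy.perm m c q
  have := hy.perm p c q
  have := hxy m p q
  have := hxy m p c
  have := hxy m c q
  rcases lt_or_gt_of_ne hmp with h₁ | h₁
  · have s := hx.segment m hm p hp c hc q hq h₁ hpc hcq
    unfold IsSegment Before Red at *
    grind
  rcases lt_or_gt_of_ne hmc with h₂ | h₂
  · have s := hx.segment p hp m hm c hc q hq h₁ h₂ hcq
    have t := hy.segment p hp m hm c hc q hq h₁ h₂ hcq
    unfold IsSegment Before Red at *
    grind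
  rcases lt_or_gt_of_ne hmq with h₃ | h₃
  · have s := hx.segment p hp c hc m hm q hq hpc h₂ h₃
    have t := hy.segment p hp c hc m hm q hq hpc h₂ h₃
    unfold IsSegment Before Red at *
    grind
  · have s := hx.segment p hp c hc q hq m hm hpc hcq h₃
    unfold IsSegment Before Red at *
    grind

theorem IsArrangement.pasch (hx : IsArrangement n x) (hp : p ∈ box n) (hb : b ∈ box n)
    (hq : q ∈ box n) (hm : m ∈ box n) (hpb : p < b) (hbq : b < q) (hmb : m ≠ b)
    (hn : ¬x b p q) (h₁ : Before x b p m) (h₂ : Before x b m q) :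
    (Before x p b m ∧ Before x p m q) ∨ (Before x q p m ∧ Before x q m b) := by
  have := hx.perm m p b
  have := hx.perm m p q
  have := hx.perm m b q
  have := hx.perm p b q
  have hmp := h₁.ne
  have hmq := h₂.ne
  rcases lt_or_gt_of_ne hmp with h | h
  · rcases lt_or_gt_of_ne hmb with h' | h'
    · have s := hx.segment p hp m hm b hb q hq h h' hbq
      unfold IsSegment Before at *
      grind
    · rcases lt_or_gt_of_ne hmq with h'' | h''
      · have s := hx.segment p hp b hb m hm q hq hpb h' h''
        unfold IsSegment Before at *
        grind
      · have s := hx.segment p hp b hb q hq m hm hpb hbq h''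
        unfold IsSegment Before at *
        grind
  · have s := hx.segment m hm p hp b hb q hq h hpb hbq
    unfold IsSegment Before at *
    grind

/-- The lines crossing `p` between `c` and `q`. -/
noncomputable def crossers (n : ℕ) (x : ℕ → ℕ → ℕ → Prop) (p c q : ℕ) : Finset ℕ :=
  open Classical in (box n).filter fun m => m ≠ p ∧ Before x p c m ∧ Before x p m q

theorem mem_crossers : m ∈ crossers n x p c q ↔
    m ∈ box n ∧ m ≠ p ∧ Before x p c m ∧ Before x p m q := by
  simp [crossers]

theorem MidAdjacent.descend (hx : IsArrangement n x) (hy : IsArrangement n y)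
    (hxy : ∀ a b c, x a b c → y a b c) (h : MidAdjacent n x y p c q)
    (hne : (crossers n x p c q).Nonempty) :
    ∃ p' c' q', MidAdjacent n x y p' c' q' ∧ (q' - p' < q - p ∨
      p' = p ∧ q' = q ∧ (crossers n x p c' q).card < (crossers n x p c q).card) := by
  classical
  obtain ⟨hp, hc, hq, hpc, hcq, -, -⟩ := id h
  set M := crossers n x p c q
  have hM : ∀ m ∈ M, m ∈ box n ∧ p < m ∧ m < q ∧ m ≠ c ∧ Before x p c m ∧ Before x p m q ∧
      Before x q m c ∧ Red x y m p q := by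
    intro m hm
    obtain ⟨hmn, hmp, h₁, h₂⟩ := mem_crossers.1 hm
    obtain ⟨h₃, h₄⟩ := h.crossing hx hy hxy hmn hmp h₁.ne.symm h₂.ne
    exact ⟨hmn, (h₄ h₁ h₂).1, (h₄ h₁ h₂).2.1, h₁.ne.symm, h₁, h₂, (h₃.1 ⟨h₁, h₂⟩).2,
      (h₄ h₁ h₂).2.2⟩
  have hM' : ∀ m ∈ box n, m ≠ q → Before x q p m → Before x q m c → m ∈ M := by
    intro m hmn hmq h₁ h₂
    have h₃ := (h.crossing hx hy hxy hmn h₁.ne.symm h₂.ne hmq).1.2 ⟨h₁, h₂⟩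
    exact mem_crossers.2 ⟨hmn, h₁.ne.symm, h₃⟩
  let S := M.filter fun b => ∃ a, (a = p ∨ a ∈ M) ∧ a < b ∧ Red x y b a q ∧
    ∀ m, m ∈ M ∨ m = p ∨ m = q → m ≠ a → m ≠ b →
      (m < b → Before x b m a) ∧ (b < m → Before x b a m)
  have hS : S.Nonempty := by
    obtain ⟨b, hb, hmin⟩ := Finset.exists_min_image M (position n x p) hne
    obtain ⟨hbn, hpb, hbq, -, -, -, -, hbred⟩ := hM b hb
    refine ⟨b, Finset.mem_filter.2 ⟨hb, p, Or.inl rfl, hpb, hbred, ?_⟩⟩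
    rintro m (hm | rfl | rfl) hma hmb
    · obtain ⟨hmn, hpm, -⟩ := hM m hm
      have hpbm : Before x p b m := by
        refine (hx.before_total p hmb).resolve_left fun h' => ?_
        have := hx.position_lt hp hmn hbn hpm.ne hpb.ne h'
        have := hmin m hm
        omega
      have := hx.perm p b m
      unfold Before at *
      grind
    · exact absurd rfl hma
    · exact ⟨fun h' => by omega, fun h' => hbred.before_iff.2 (by omega)⟩
  obtain ⟨b, hbS, hbmax⟩ := Finset.exists_max_image S id hS
  obtain ⟨hb, a, ha, hab, hred, hI⟩ := Finset.mem_filter.1 hbS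
  obtain ⟨hbn, hpb, hbq, hbc, hcb, -, hqbc, hbred⟩ := hM b hb
  have han : a ∈ box n := by
    rcases ha with rfl | ha
    · exact hp
    · exact (hM a ha).1
  have hpa : p ≤ a := by
    rcases ha with rfl | ha
    · exact le_rfl
    · exact (hM a ha).2.1.le
  by_cases hadj : ∀ m ∈ box n, m ≠ b → Before x b a m → ¬Before x b m q
  · refine ⟨a, b, q, ⟨han, hbn, hq, hab, hbq, hred, hadj⟩, ?_⟩
    rcases hpa.lt_or_eq with hpa | rfl
    · left; omega
    refine Or.inr ⟨rfl, rfl, Finset.card_lt_card ?_⟩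
    rw [Finset.ssubset_iff_of_subset]
    · exact ⟨b, hb, fun hb' => (mem_crossers.1 hb').2.2.1.ne rfl⟩
    · intro m hm
      obtain ⟨hmn, hmp, h₁, h₂⟩ := mem_crossers.1 hm
      exact mem_crossers.2 ⟨hmn, hmp,
        hx.before_trans hp hc hbn hmn hpc.ne hpb.ne hmp.symm hcb h₁, h₂⟩
  push Not at hadj
  obtain ⟨l₀, hl₀, hl₀b, hal₀, hlq₀⟩ := hadj
  obtain ⟨l, hlF, hlmin⟩ := Finset.exists_min_image
    ((box n).filter fun m => m ≠ b ∧ Before x b a m ∧ Before x b m q) (position n x b)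
    ⟨l₀, Finset.mem_filter.2 ⟨hl₀, hl₀b, hal₀, hlq₀⟩⟩
  obtain ⟨hln, hlb, hal, hlq⟩ := Finset.mem_filter.1 hlF
  have hbpl : Before x b p l := by
    by_cases hpa' : p = a
    · rwa [hpa']
    · exact hx.before_trans hbn hp han hln hpb.ne' hab.ne' hlb.symm
        ((hI p (Or.inr (Or.inl rfl)) hpa' hpb.ne).1 hpb) hal
  have hl : l ∈ M := by
    rcases hx.pasch hp hbn hq hln hpb hbq hlb hbred.2 hbpl hlq with ⟨h₁, h₂⟩ | ⟨h₁, h₂⟩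
    · exact mem_crossers.2 ⟨hln, hbpl.ne.symm,
        hx.before_trans hp hc hbn hln hpc.ne hpb.ne hbpl.ne hcb h₁, h₂⟩
    · exact hM' l hln hlq.ne h₁
        (hx.before_trans hq hln hbn hc hlq.ne.symm hbq.ne' hcq.ne' h₂ hqbc)
  obtain ⟨-, hpl, hlq', -⟩ := hM l hl
  have hbl : b < l := by
    by_contra h'
    exact hx.not_before hal ((hI l (Or.inl hl) hal.ne.symm hlb).1 (by omega))
  have hmin : ∀ m ∈ box n, m ≠ b → Before x b a m → Before x b m q → ¬Before x b m l := by
    intro m hmn hmb h₁ h₂ h₃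
    have := hlmin m (Finset.mem_filter.2 ⟨hmn, hmb, h₁, h₂⟩)
    have := hx.position_lt hbn hmn hln hmb.symm hlb.symm h₃
    omega
  rcases hred.split hy hxy hbn han hq hln hab.ne' hbq.ne hlb.symm (by omega) hal hlq with h' | h'
  · refine ⟨a, b, l, ⟨han, hbn, hln, hab, hbl, h', fun m hmn hmb h₁ h₂ => ?_⟩, ?_⟩
    · exact hmin m hmn hmb h₁ (hx.before_trans hbn hmn hln hq hmb.symm hlb.symm hbq.ne h₂ hlq) h₂
    · left; omega
  exfalso
  have hlS : l ∈ S := by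
    refine Finset.mem_filter.2 ⟨hl, b, Or.inr hb, hbl, h'.rotate hx hy, fun m hm hmb hml => ?_⟩
    have hmn : m ∈ box n := by
      rcases hm with hm | rfl | rfl
      · exact (hM m hm).1
      · exact hp
      · exact hq
    have := hx.perm m b l
    rcases lt_or_gt_of_ne hmb with hmb' | hmb'
    · have hbml : Before x b m l := by
        by_cases hma : m = a
        · rwa [hma]
        · exact hx.before_trans hbn hmn han hln hmb.symm hab.ne' hlb.symm
            ((hI m hm hma hmb).1 hmb') hal
      clear hI hM hM' hmin hlmin hbmax
      unfold Before at *
      grind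
    · have hblm : Before x b l m := by
        rcases eq_or_ne m q with rfl | hmq
        · exact hlq
        · refine (hx.before_total b hml).resolve_left fun hml' => ?_
          exact hmin m hmn hmb ((hI m hm (by omega) hmb).2 hmb')
            (hx.before_trans hbn hmn hln hq hmb.symm hlb.symm hbq.ne hml' hlq) hml'
      clear hI hM hM' hmin hlmin hbmax
      unfold Before at *
      grind
  have := hbmax l hlS
  simp at this; omega

theorem exists_flip (hx : IsArrangement n x) (hy : IsArrangement n y)
    (hxy : ∀ a b c, x a b c → y a b c)
    (h : ∃ a ∈ box n, ∃ b ∈ box n, ∃ c ∈ box n, a < b ∧ b < c ∧ Red x y b a c) :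
    ∃ p c q, MidAdjacent n x y p c q ∧
      (∀ m ∈ box n, m ≠ p → Before x p c m → ¬Before x p m q) ∧
      ∀ m ∈ box n, m ≠ q → Before x q p m → ¬Before x q m c := by
  obtain ⟨p, c, q, h⟩ := exists_midAdjacent hx hy hxy h
  induction hr : toLex (q - p, (crossers n x p c q).card) using WellFoundedLT.induction
    generalizing p c q with
  | _ r ih =>
    subst hr
    rcases (crossers n x p c q).eq_empty_or_nonempty with he | hne
    · have key : ∀ m ∈ box n, m ≠ p → Before x p c m → ¬Before x p m q :=
        fun m hm hmp h₁ h₂ => Finset.eq_empty_iff_forall_notMem.1 he m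
          (mem_crossers.2 ⟨hm, hmp, h₁, h₂⟩)
      refine ⟨p, c, q, h, key, fun m hm hmq h₁ h₂ => ?_⟩
      obtain ⟨h₃, h₄⟩ := (h.crossing hx hy hxy hm h₁.ne.symm h₂.ne hmq).1.2 ⟨h₁, h₂⟩
      exact key m hm h₁.ne.symm h₃ h₄
    · obtain ⟨p', c', q', h', hlt⟩ := h.descend hx hy hxy hne
      refine ih _ ?_ p' c' q' h' rfl
      rw [Prod.Lex.toLex_lt_toLex]
      rcases hlt with hlt | ⟨rfl, rfl, hlt⟩
      · exact Or.inl hlt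
      · exact Or.inr ⟨rfl, hlt⟩

theorem insert_pair_mem_binom (ha : a ∈ box n) (hb : b ∈ box n) (hc : c ∈ box n) (hab : a ≠ b)
    (hac : a ≠ c) (hbc : b ≠ c) : {a, b, c} ∈ binom n 3 := by
  refine Finset.mem_powersetCard.2 ⟨?_, Finset.card_eq_three.2 ⟨a, b, c, hab, hac, hbc, rfl⟩⟩
  simp [Finset.insert_subset_iff, *]

theorem isClosedSet_two_iff {X : Finset (Finset ℕ)} : IsClosedSet n 2 X ↔
    ∀ i ∈ box n, ∀ a ∈ box n, ∀ b ∈ box n, ∀ c ∈ box n, i ≠ a → i ≠ b → i ≠ c → a < b → b < c →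
      {i, a, b} ∈ X → {i, b, c} ∈ X → {i, a, c} ∈ X := by
  constructor
  · intro h i hi a ha b hb c hc hia hib hic
    exact h {i} (by simp [binom, hi]) a ha b hb c hc (by simpa using hia.symm)
      (by simpa using hib.symm) (by simpa using hic.symm)
  · intro h I hI a ha b hb c hc hIa hIb hIc
    obtain ⟨hIn, hI⟩ := Finset.mem_powersetCard.1 hI
    obtain ⟨i, rfl⟩ := Finset.card_eq_one.1 hI
    simp only [Finset.mem_singleton] at hIa hIb hIc
    exact h i (hIn (Finset.mem_singleton_self i)) a ha b hb c hc (Ne.symm hIa) (Ne.symm hIb)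
      (Ne.symm hIc)

theorem consistent_iff_isArrangement {X : Finset (Finset ℕ)} (hX : X ⊆ binom n 3) :
    Consistent n 2 X ↔ IsArrangement n fun a b c => {a, b, c} ∈ X := by
  have hco : ∀ a ∈ box n, ∀ b ∈ box n, ∀ c ∈ box n, a ≠ b → a ≠ c → b ≠ c →
      ({a, b, c} ∈ binom n 3 \ X ↔ {a, b, c} ∉ X) := by
    intro a ha b hb c hc hab hac hbc
    simp [insert_pair_mem_binom ha hb hc hab hac hbc]
  have hperm : ∀ a b c : ℕ, (({a, b, c} : Finset ℕ) = {b, a, c}) ∧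
      (({a, b, c} : Finset ℕ) = {a, c, b}) :=
    fun a b c => ⟨Finset.insert_comm _ _ _, by rw [Finset.pair_comm]⟩
  rw [Consistent, isClosedSet_two_iff, isClosedSet_two_iff]
  constructor
  · rintro ⟨-, h₁, h₂⟩
    refine ⟨fun a b c => by rw [(hperm a b c).1], fun a b c => by rw [(hperm a b c).2], ?_⟩
    intro a ha b hb c hc d hd hab hbc hcd
    have key : ∀ i ∈ box n, ∀ a ∈ box n, ∀ b ∈ box n, ∀ c ∈ box n, i ≠ a → i ≠ b → i ≠ c →
        a < b → b < c → {i, a, b} ∉ X → {i, b, c} ∉ X → {i, a, c} ∉ X := by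
      intro i hi a ha b hb c hc hia hib hic hab hbc
      rw [← hco i hi a ha b hb hia hib hab.ne, ← hco i hi b hb c hc hib hic hbc.ne,
        ← hco i hi a ha c hc hia hic (hab.trans hbc).ne]
      exact h₂ i hi a ha b hb c hc hia hib hic hab hbc
    have hac := hab.trans hbc
    have hbd := hbc.trans hcd
    have had := hab.trans hbd
    have ha₁ := h₁ a ha b hb c hc d hd hab.ne hac.ne had.ne hbc hcd
    have hb₁ := h₁ b hb a ha c hc d hd hab.ne' hbc.ne hbd.ne hac hcd
    have hc₁ := h₁ c hc a ha b hb d hd hac.ne' hbc.ne' hcd.ne hab hbd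
    have hd₁ := h₁ d hd a ha b hb c hc had.ne' hbd.ne' hcd.ne' hab hbc
    have ha₂ := key a ha b hb c hc d hd hab.ne hac.ne had.ne hbc hcd
    have hb₂ := key b hb a ha c hc d hd hab.ne' hbc.ne hbd.ne hac hcd
    have hc₂ := key c hc a ha b hb d hd hac.ne' hbc.ne' hcd.ne hab hbd
    have hd₂ := key d hd a ha b hb c hc had.ne' hbd.ne' hcd.ne' hab hbc
    simp only [(hperm b a c).1, (hperm b a d).1] at hb₁ hb₂
    simp only [(hperm c a b).1, (hperm c a d).1, (hperm c b d).1, (hperm a c b).2] at hc₁ hc₂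
    simp only [(hperm d a b).1, (hperm d a c).1, (hperm d b c).1, (hperm a d b).2,
      (hperm a d c).2, (hperm b d c).2] at hd₁ hd₂
    exact ⟨ha₁, hb₁, hc₁, hd₁, ha₂, hb₂, hc₂, hd₂⟩
  · intro h
    refine ⟨hX, fun i hi a ha b hb c hc hia hib hic hab hbc =>
      (h.line_trans hi ha hb hc hia hib hic hab hbc).1,
      fun i hi a ha b hb c hc hia hib hic hab hbc => ?_⟩
    rw [hco i hi a ha b hb hia hib hab.ne, hco i hi b hb c hc hib hic hbc.ne,
      hco i hi a ha c hc hia hic (hab.trans hbc).ne]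
    exact (h.line_trans hi ha hb hc hia hib hic hab hbc).2

theorem insert_pair_eq_iff_of_lt (hab : a < b) (hbc : b < c) (hij : i < j) (hjk : j < k) :
    ({a, b, c} : Finset ℕ) = {i, j, k} ↔ a = i ∧ b = j ∧ c = k := by
  constructor
  · intro h
    simp only [Finset.ext_iff, Finset.mem_insert, Finset.mem_singleton] at h
    have := h a
    have := h b
    have := h c
    have := h i
    have := h j
    have := h k
    omega
  · rintro ⟨rfl, rfl, rfl⟩
    rfl

theorem IsArrangement.insert_triple (hx : IsArrangement n x) (hpj : p < j) (hjq : j < q)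
    (hj : ∀ m ∈ box n, m ≠ j → Before x j p m → ¬Before x j m q)
    (hp : ∀ m ∈ box n, m ≠ p → Before x p j m → ¬Before x p m q)
    (hq : ∀ m ∈ box n, m ≠ q → Before x q p m → ¬Before x q m j) :
    IsArrangement n fun a b c => x a b c ∨ ({a, b, c} : Finset ℕ) = {p, j, q} := by
  refine ⟨fun a b c => by rw [hx.swap_left, Finset.insert_comm],
    fun a b c => by rw [hx.swap_right, Finset.pair_comm], ?_⟩
  intro a ha b hb c hc d hd hab hbc hcd
  have s := hx.segment a ha b hb c hc d hd hab hbc hcd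
  have := hx.perm a b c
  have := hx.perm a b d
  have := hx.perm a c d
  have := hx.perm b c d
  simp only [insert_pair_eq_iff_of_lt hab hbc hpj hjq,
    insert_pair_eq_iff_of_lt hab (hbc.trans hcd) hpj hjq,
    insert_pair_eq_iff_of_lt (hab.trans hbc) hcd hpj hjq,
    insert_pair_eq_iff_of_lt hbc hcd hpj hjq]
  have between : ∀ m ∈ box n, m ≠ p → m ≠ j → m ≠ q → ¬(Before x j p m ∧ Before x j m q) ∧
      ¬(Before x p j m ∧ Before x p m q) ∧ ¬(Before x q p m ∧ Before x q m j) :=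
    fun m hm hmp hmj hmq =>
      ⟨fun h => hj m hm hmj h.1 h.2, fun h => hp m hm hmp h.1 h.2, fun h => hq m hm hmq h.1 h.2⟩
  clear hj hp hq
  by_cases h₁ : a = p ∧ b = j ∧ c = q
  · obtain ⟨rfl, rfl, rfl⟩ := h₁
    have := between d hd (by omega) (by omega) (by omega)
    unfold IsSegment Before at *
    grind
  by_cases h₂ : a = p ∧ b = j ∧ d = q
  · obtain ⟨rfl, rfl, rfl⟩ := h₂
    have := between c hc (by omega) (by omega) (by omega)
    unfold IsSegment Before at *
    grind
  by_cases h₃ : a = p ∧ c = j ∧ d = q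
  · obtain ⟨rfl, rfl, rfl⟩ := h₃
    have := between b hb (by omega) (by omega) (by omega)
    unfold IsSegment Before at *
    grind
  by_cases h₄ : b = p ∧ c = j ∧ d = q
  · obtain ⟨rfl, rfl, rfl⟩ := h₄
    have := between a ha (by omega) (by omega) (by omega)
    unfold IsSegment Before at *
    grind
  simpa only [h₁, h₂, h₃, h₄, or_false] using s

theorem exists_red {X Y : Finset (Finset ℕ)} (hY : Y ⊆ binom n 3) (hXY : X ⊂ Y) :
    ∃ a ∈ box n, ∃ b ∈ box n, ∃ c ∈ box n, a < b ∧ b < c ∧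
      Red (fun a b c => {a, b, c} ∈ X) (fun a b c => {a, b, c} ∈ Y) b a c := by
  obtain ⟨I, hIY, hIX⟩ := Finset.exists_of_ssubset hXY
  obtain ⟨hIn, hI⟩ := Finset.mem_powersetCard.1 (hY hIY)
  let f := I.orderEmbOfFin hI
  have hf : ∀ i, f i ∈ I := Finset.orderEmbOfFin_mem I hI
  have h₁ : f 0 < f 1 := f.lt_iff_lt.2 (by decide)
  have h₂ : f 1 < f 2 := f.lt_iff_lt.2 (by decide)
  have hIf : {f 1, f 0, f 2} = I := by
    refine Finset.eq_of_subset_of_card_le (by simp [Finset.insert_subset_iff, hf]) ?_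
    rw [hI, Finset.card_eq_three.2 ⟨_, _, _, h₁.ne', h₂.ne, (h₁.trans h₂).ne, rfl⟩]
  refine ⟨f 0, hIn (hf 0), f 1, hIn (hf 1), f 2, hIn (hf 2), h₁, h₂, ?_⟩
  simp only [Red, hIf]
  exact ⟨hIY, hIX⟩

/-- If `X ⊊ Y` are consistent subsets of `binom([n],3)`, then the ascent set
`Asc(X, Y)` is nonempty. -/
theorem ascent_nonempty (n : ℕ) (hn : 1 ≤ n) (X Y : Finset (Finset ℕ))
    (hX : Consistent n 2 X) (hY : Consistent n 2 Y) (hXY : X ⊂ Y) :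
    ∃ I ∈ Y \ X, Consistent n 2 (X ∪ {I}) := by
  have hX₃ := (consistent_iff_isArrangement hX.1).1 hX
  have hY₃ := (consistent_iff_isArrangement hY.1).1 hY
  obtain ⟨p, c, q, h, hp, hq⟩ :=
    exists_flip hX₃ hY₃ (fun a b c h => hXY.subset h) (exists_red hY.1 hXY)
  have hred := h.red.rotate hX₃ hY₃
  refine ⟨{p, c, q}, Finset.mem_sdiff.2 hred, ?_⟩
  rw [consistent_iff_isArrangement (Finset.union_subset hX.1
    (Finset.singleton_subset_iff.2 (hY.1 hred.1)))]
  simpa only [Finset.mem_union, Finset.mem_singleton] using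
    hX₃.insert_triple h.left_lt h.lt_right h.adjacent hp hq
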